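/- Let a, b, μ, G > 0, let Γ_{a,b}(θ) = (a² − b²)·cos θ·sin θ / (a²·sin²θ + b²·cos²θ), and define the flow ψ : ℝ × ℝ → ℝ² by ψ(θ,t) = exp(−3·μ·G·t)·(a·cos θ, b·sin θ). Then for every θ and t, the flow satisfies the anisotropic minimizing-energy velocity law up to a tangential term: ∂ψ/∂t(θ,t) = 3·μ·G·( ∂²ψ/∂θ²(θ,t) − Γ_{a,b}(θ)·∂ψ/∂θ(θ,t) ) + 3·μ·G·Γ_{a,b}(θ)·∂ψ/∂θ(θ,t); that is, ∂ψ/∂t − 3μG·(∂²_θψ − Γ·∂_θψ) is exactly the tangential vector 3μG·Γ_{a,b}(θ)·∂_θψ, which does not affect the geometric evolution of the interface. -/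

import Mathlib

open Real

/-- The Christoffel symbol of the metric induced on the circle by the ellipse embedding. -/
noncomputable def ellipseChristoffel (a b : ℝ) : ℝ → ℝ :=
  fun θ => (a ^ 2 - b ^ 2) * Real.cos θ * Real.sin θ /
    (a ^ 2 * Real.sin θ ^ 2 + b ^ 2 * Real.cos θ ^ 2)

/-- The shrinking-ellipse flow `ψ(θ,t) = exp(−3μGt) • (a cosθ, b sinθ)`. -/
noncomputable def shrinkingEllipseFlow (a b μ G : ℝ) : ℝ → ℝ → ℝ × ℝ :=
  fun θ t => Real.exp (-3 * μ * G * t) • (a * Real.cos θ, b * Real.sin θ)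

/-- The shrinking-ellipse flow satisfies the anisotropic minimizing-energy velocity law
up to a tangential term: `∂ψ/∂t = 3μG (∂²_θψ − Γ ∂_θψ) + 3μG Γ ∂_θψ`, so the
difference `∂ψ/∂t − 3μG(∂²_θψ − Γ ∂_θψ)` is exactly the tangential vector
`3μG Γ(θ) ∂_θψ`. -/
theorem shrinkingEllipseFlow_velocity_law (a b μ G : ℝ)
    (ha : 0 < a) (hb : 0 < b) (hμ : 0 < μ) (hG : 0 < G) (θ t : ℝ) :
    deriv (fun t' => shrinkingEllipseFlow a b μ G θ t') t =
      (3 * μ * G) •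
          (deriv (deriv (fun θ' => shrinkingEllipseFlow a b μ G θ' t)) θ
            - ellipseChristoffel a b θ • deriv (fun θ' => shrinkingEllipseFlow a b μ G θ' t) θ)
        + (3 * μ * G * ellipseChristoffel a b θ) •
            deriv (fun θ' => shrinkingEllipseFlow a b μ G θ' t) θ := by
  have h1 : ∀ x : ℝ, HasDerivAt (fun θ' => shrinkingEllipseFlow a b μ G θ' t)
      (Real.exp (-3 * μ * G * t) • (a * (-Real.sin x), b * Real.cos x)) x := fun x =>
    (((Real.hasDerivAt_cos x).const_mul a).prodMk
      ((Real.hasDerivAt_sin x).const_mul b)).const_smul (Real.exp (-3 * μ * G * t))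
  have h2 : HasDerivAt (fun x : ℝ => Real.exp (-3 * μ * G * t) •
        (a * (-Real.sin x), b * Real.cos x))
      (Real.exp (-3 * μ * G * t) • (a * (-Real.cos θ), b * (-Real.sin θ))) θ :=
    (((Real.hasDerivAt_sin θ).neg.const_mul a).prodMk
      ((Real.hasDerivAt_cos θ).const_mul b)).const_smul (Real.exp (-3 * μ * G * t))
  have h3 : HasDerivAt (fun t' => shrinkingEllipseFlow a b μ G θ t')
      ((Real.exp (-3 * μ * G * t) * (-3 * μ * G * 1)) •
        ((a * Real.cos θ, b * Real.sin θ) : ℝ × ℝ)) t :=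
    (((hasDerivAt_id t).const_mul (-3 * μ * G)).exp).smul_const _
  have h4 : deriv (fun θ' => shrinkingEllipseFlow a b μ G θ' t) =
      fun x : ℝ => Real.exp (-3 * μ * G * t) • (a * (-Real.sin x), b * Real.cos x) :=
    funext fun x => (h1 x).deriv
  rw [h3.deriv, h4, h2.deriv]
  ext
  · simp only [Prod.smul_mk, Prod.mk_sub_mk, Prod.mk_add_mk, smul_eq_mul]
    ring
  · simp only [Prod.smul_mk, Prod.mk_sub_mk, Prod.mk_add_mk, smul_eq_mul]
    ring
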